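/- Let δ ∈ ℝ and let φ: U → V be a C^∞ diffeomorphism between open subsets of ℝⁿ with everywhere positive Jacobian determinant J = det Dφ. Let S^{ab} = S^{ba}, γ^a, θ be smooth functions on U, and define transformed data on V by S'^{ab} = (J^{−δ}·∂_cφ^a·∂_dφ^b·S^{cd})∘φ^{−1}, γ'^a = (J^{−δ}·∂_cφ^a·(γ^c + S^{cd}∂_d log J))∘φ^{−1}, and θ' = (J^{−δ}·(θ + 2γ^a∂_a log J + (∂_a log J)S^{ab}(∂_b log J)))∘φ^{−1}. Let Δ_λ and Δ'_λ denote the canonical pencil operators of weight δ built from (S, γ, θ) on U and from (S', γ', θ') on V respectively, where Δ_λ f = (1/2)(S^{ab}∂_a∂_b f + (∂_b S^{ba})∂_a f + (2λ+δ−1)γ^a∂_a f + λ(∂_aγ^a)f + λ(λ+δ−1)θ f). Then for every λ ∈ ℝ and every smooth function f on V: Δ'_λ f = (J^{−(λ+δ)} · Δ_λ(J^λ · (f∘φ)))∘φ^{−1}. -/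

import Mathlib

open MeasureTheory Real

/-- Partial derivative of a function on ℝⁿ in the direction of the `a`-th coordinate. -/
noncomputable def pd {n : ℕ} (a : Fin n) (f : (Fin n → ℝ) → ℝ) : (Fin n → ℝ) → ℝ :=
  fun x => fderiv ℝ f x (Pi.single a 1)

/-- The canonical pencil operator of weight `δ` with data `(S, γ, θ)`. -/
noncomputable def pencil {n : ℕ} (δ lam : ℝ) (S : Fin n → Fin n → (Fin n → ℝ) → ℝ)
    (γ : Fin n → (Fin n → ℝ) → ℝ) (θ : (Fin n → ℝ) → ℝ)
    (f : (Fin n → ℝ) → ℝ) (x : Fin n → ℝ) : ℝ :=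
  (1/2) * (∑ a, ∑ b, S a b x * pd a (pd b f) x
    + ∑ a, (∑ b, pd b (S b a) x) * pd a f x
    + (2*lam + δ - 1) * ∑ a, γ a x * pd a f x
    + lam * (∑ a, pd a (γ a) x) * f x
    + lam * (lam + δ - 1) * θ x * f x)

open Filter Topology

section PartialDerivatives

variable {n : ℕ} {x : Fin n → ℝ} {f g : (Fin n → ℝ) → ℝ}

lemma pd_mul (a : Fin n) (hf : DifferentiableAt ℝ f x) (hg : DifferentiableAt ℝ g x) :
    pd a (fun z => f z * g z) x = pd a f x * g x + f x * pd a g x := by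
  simp only [pd, fderiv_fun_mul hf hg]
  simp
  ring

lemma pd_add (a : Fin n) (hf : DifferentiableAt ℝ f x) (hg : DifferentiableAt ℝ g x) :
    pd a (fun z => f z + g z) x = pd a f x + pd a g x := by
  simp [pd, fderiv_fun_add hf hg]

lemma pd_sum {ι : Type*} (s : Finset ι) (a : Fin n) {F : ι → (Fin n → ℝ) → ℝ}
    (hF : ∀ i ∈ s, DifferentiableAt ℝ (F i) x) :
    pd a (fun z => ∑ i ∈ s, F i z) x = ∑ i ∈ s, pd a (F i) x := by
  simp [pd, fderiv_fun_sum hF]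

lemma pd_congr (a : Fin n) (h : f =ᶠ[𝓝 x] g) : pd a f x = pd a g x := by
  simp [pd, h.fderiv_eq]

lemma fderiv_apply_eq_sum_pd (f : (Fin n → ℝ) → ℝ) (x v : Fin n → ℝ) :
    fderiv ℝ f x v = ∑ e, v e * pd e f x := by
  conv_lhs => rw [pi_eq_sum_univ' v]
  simp [pd]

lemma pd_comp (a : Fin n) {φ : (Fin n → ℝ) → (Fin n → ℝ)}
    (hf : DifferentiableAt ℝ f (φ x)) (hφ : DifferentiableAt ℝ φ x) :
    pd a (fun z => f (φ z)) x = ∑ e, pd a (fun z => φ z e) x * pd e f (φ x) := by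
  have h : fderiv ℝ (fun z => f (φ z)) x = (fderiv ℝ f (φ x)).comp (fderiv ℝ φ x) :=
    fderiv_comp x hf hφ
  simp only [pd, h, ContinuousLinearMap.comp_apply]
  rw [fderiv_apply_eq_sum_pd]
  refine Finset.sum_congr rfl fun e _ => ?_
  rw [pd, fderiv_pi (fun i => differentiableAt_pi.1 hφ i)]
  rfl

lemma pd_rpow (a : Fin n) (r : ℝ) (hf : DifferentiableAt ℝ f x) (hpos : 0 < f x) :
    pd a (fun z => f z ^ r) x = r * f x ^ r * pd a (fun z => Real.log (f z)) x := by
  simp only [pd]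
  rw [(hf.hasFDerivAt.rpow_const (p := r) (Or.inl hpos.ne')).fderiv,
    (hf.hasFDerivAt.log hpos.ne').fderiv]
  simp [Real.rpow_sub_one hpos.ne']
  ring

lemma pd_comm (a b : Fin n) (hf : ContDiffAt ℝ (⊤ : ℕ∞) f x) :
    pd a (pd b f) x = pd b (pd a f) x := by
  have hsymm : IsSymmSndFDerivAt ℝ f x := hf.isSymmSndFDerivAt (by
    rw [minSmoothness_of_isRCLikeNormedField]
    exact WithTop.coe_le_coe.2 (le_top : (2 : ℕ∞) ≤ ⊤))
  have hd : DifferentiableAt ℝ (fderiv ℝ f) x :=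
    (hf.fderiv_right (m := 1) (by norm_cast)).differentiableAt (by simp)
  have key : ∀ c d : Fin n, pd c (pd d f) x
      = fderiv ℝ (fderiv ℝ f) x (Pi.single c 1) (Pi.single d 1) := by
    intro c d
    change fderiv ℝ (fun z => fderiv ℝ f z (Pi.single d 1)) x (Pi.single c 1) = _
    rw [fderiv_clm_apply hd (differentiableAt_const _)]
    simp
  rw [key, key, hsymm.eq]

lemma contDiffOn_pd {U : Set (Fin n → ℝ)} (hU : IsOpen U) (a : Fin n)
    (hf : ContDiffOn ℝ (⊤ : ℕ∞) f U) : ContDiffOn ℝ (⊤ : ℕ∞) (pd a f) U :=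
  (hf.fderiv_of_isOpen (m := (⊤ : ℕ∞)) hU (by norm_cast)).clm_apply contDiffOn_const

/-- Jacobi's formula for the derivative of a determinant. -/
lemma pd_det (e : Fin n) {M : (Fin n → ℝ) → Matrix (Fin n) (Fin n) ℝ}
    (hM : ∀ a c, DifferentiableAt ℝ (fun z => M z a c) x) :
    pd e (fun z => (M z).det) x
      = ∑ a, ∑ c, pd e (fun z => M z a c) x * (M x).adjugate c a := by
  let D : ContinuousMultilinearMap ℝ (fun _ : Fin n => Fin n → ℝ) ℝ :=
    ⟨(Matrix.detRowAlternating (n := Fin n) (R := ℝ)).toMultilinearMap,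
      Continuous.matrix_det continuous_id⟩
  have hrow : HasFDerivAt (fun z a c => M z a c)
      (ContinuousLinearMap.pi fun a => ContinuousLinearMap.pi fun c =>
        fderiv ℝ (fun z => M z a c) x) x :=
    hasFDerivAt_pi.2 fun a => hasFDerivAt_pi.2 fun c => (hM a c).hasFDerivAt
  have hdet := (D.hasFDerivAt (fun a c => M x a c)).comp x hrow
  change fderiv ℝ (D ∘ fun z a c => M z a c) x _ = _
  rw [hdet.fderiv, ContinuousLinearMap.comp_apply, ContinuousMultilinearMap.linearDeriv_apply]
  refine Finset.sum_congr rfl fun a _ => ?_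
  change ((M x).updateRow a _).det = _
  rw [← Matrix.cramer_transpose_apply, Matrix.cramer_eq_adjugate_mulVec,
    ← Matrix.adjugate_transpose]
  simp only [Matrix.mulVec, dotProduct, Matrix.transpose_apply]
  exact Finset.sum_congr rfl fun c _ => mul_comm _ _

end PartialDerivatives

section ChangeOfCoordinates

variable {n : ℕ} {U V : Set (Fin n → ℝ)} {φ ψ : (Fin n → ℝ) → (Fin n → ℝ)}
  {J : (Fin n → ℝ) → ℝ}

lemma sum_mul_of_dual {ι : Type*} [Fintype ι] [DecidableEq ι] {P Q : ι → ι → ℝ}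
    (h : ∀ c e, ∑ a, P a c * Q a e = if c = e then 1 else 0) (W : ι → ι → ℝ) :
    ∑ a, ∑ e, ∑ c, Q a e * (P a c * W e c) = ∑ c, W c c := by
  calc ∑ a, ∑ e, ∑ c, Q a e * (P a c * W e c)
      = ∑ e, ∑ c, (∑ a, P a c * Q a e) * W e c := by
        rw [Finset.sum_comm]
        refine Finset.sum_congr rfl fun e _ => ?_
        rw [Finset.sum_comm]
        refine Finset.sum_congr rfl fun c _ => ?_
        rw [Finset.sum_mul]
        exact Finset.sum_congr rfl fun a _ => by ring
    _ = ∑ c, W c c := by simp [h]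

lemma sum_pd_mul_pd_inverse (hU : IsOpen U) (hV : IsOpen V)
    (hφ : ContDiffOn ℝ (⊤ : ℕ∞) φ U) (hψ : ContDiffOn ℝ (⊤ : ℕ∞) ψ V)
    (hφUV : Set.MapsTo φ U V) (hleft : ∀ x ∈ U, ψ (φ x) = x) {x : Fin n → ℝ} (hx : x ∈ U)
    (c e : Fin n) :
    ∑ a, pd c (fun z => φ z a) x * pd a (fun z => ψ z e) (φ x) = if c = e then 1 else 0 := by
  have hφx : DifferentiableAt ℝ φ x :=
    (hφ.contDiffAt (hU.mem_nhds hx)).differentiableAt (by simp)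
  have hψx : DifferentiableAt ℝ ψ (φ x) :=
    (hψ.contDiffAt (hV.mem_nhds (hφUV hx))).differentiableAt (by simp)
  rw [← pd_comp c (f := fun z => ψ z e) (differentiableAt_pi.1 hψx e) hφx]
  have hid : (fun z => ψ (φ z) e) =ᶠ[𝓝 x] fun z => z e :=
    Filter.eventually_of_mem (hU.mem_nhds hx) fun z hz => by simp [hleft z hz]
  rw [pd_congr c hid, pd, (hasFDerivAt_apply e x).fderiv]
  simp [Pi.single_apply, eq_comm]

lemma pd_log_jacobian (hU : IsOpen U) (hV : IsOpen V)
    (hφ : ContDiffOn ℝ (⊤ : ℕ∞) φ U) (hψ : ContDiffOn ℝ (⊤ : ℕ∞) ψ V)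
    (hφUV : Set.MapsTo φ U V) (hleft : ∀ x ∈ U, ψ (φ x) = x)
    (hJ : ∀ x, J x = Matrix.det (Matrix.of fun a c : Fin n => pd c (fun y => φ y a) x))
    (hJpos : ∀ x ∈ U, 0 < J x) {x : Fin n → ℝ} (hx : x ∈ U) (e : Fin n) :
    pd e (fun z => Real.log (J z)) x
      = ∑ a, ∑ c, pd e (pd c fun z => φ z a) x * pd a (fun z => ψ z c) (φ x) := by
  have hφa (a : Fin n) : ContDiffOn ℝ (⊤ : ℕ∞) (fun z => φ z a) U := contDiffOn_pi.1 hφ a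
  have hM (a c : Fin n) : DifferentiableAt ℝ (pd c fun z => φ z a) x :=
    ((contDiffOn_pd hU c (hφa a)).contDiffAt (hU.mem_nhds hx)).differentiableAt (by simp)
  set M : (Fin n → ℝ) → Matrix (Fin n) (Fin n) ℝ :=
    fun z => Matrix.of fun a c => pd c (fun y => φ y a) z with hMdef
  set N : Matrix (Fin n) (Fin n) ℝ := Matrix.of fun c a => pd a (fun z => ψ z c) (φ x)
  have hNM : N * M x = 1 := by
    ext e c
    simp only [Matrix.mul_apply, Matrix.one_apply, N, hMdef, Matrix.of_apply]
    rw [← if_congr (eq_comm (a := c)) rfl rfl,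
      ← sum_pd_mul_pd_inverse hU hV hφ hψ hφUV hleft hx c e]
    exact Finset.sum_congr rfl fun a _ => mul_comm _ _
  have hadj : (M x).adjugate = (M x).det • N := by
    rw [← mul_one (M x).adjugate, ← mul_eq_one_comm.1 hNM, ← mul_assoc,
      Matrix.adjugate_mul, smul_mul_assoc, one_mul]
  have hJM : J = fun z => (M z).det := funext hJ
  have hJd : DifferentiableAt ℝ J x := by
    rw [hJM]
    simp only [Matrix.det_apply]
    have hM' (a c : Fin n) : DifferentiableAt ℝ (fun z => M z a c) x := hM a c
    fun_prop
  have hpos := hJpos x hx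
  have hpd : pd e J x = ∑ a, ∑ c, pd e (pd c fun z => φ z a) x * (M x).adjugate c a := by
    rw [hJM]
    exact pd_det e hM
  have hlog : pd e (fun z => Real.log (J z)) x = (J x)⁻¹ * pd e J x := by
    simp [pd, (hJd.hasFDerivAt.log hpos.ne').fderiv]
  rw [hlog, hpd, hadj, ← congrFun hJM x, Finset.mul_sum]
  refine Finset.sum_congr rfl fun a _ => ?_
  rw [Finset.mul_sum]
  refine Finset.sum_congr rfl fun c _ => ?_
  simp only [Matrix.smul_apply, smul_eq_mul, N, Matrix.of_apply]
  field_simp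

lemma contDiffOn_jacobian (hU : IsOpen U) (hφ : ContDiffOn ℝ (⊤ : ℕ∞) φ U)
    (hJ : ∀ x, J x = Matrix.det (Matrix.of fun a c : Fin n => pd c (fun y => φ y a) x)) :
    ContDiffOn ℝ (⊤ : ℕ∞) J U := by
  rw [funext hJ]
  simp only [Matrix.det_apply, Matrix.of_apply]
  refine ContDiffOn.sum fun σ _ => ContDiffOn.const_smul _ (contDiffOn_prod fun i _ => ?_)
  exact contDiffOn_pd hU _ (contDiffOn_pi.1 hφ _)

/-- The divergence of a vector density of weight `δ` under a change of coordinates. -/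
lemma sum_pd_vectorDensity (hU : IsOpen U) (hV : IsOpen V)
    (hφ : ContDiffOn ℝ (⊤ : ℕ∞) φ U) (hψ : ContDiffOn ℝ (⊤ : ℕ∞) ψ V)
    (hφUV : Set.MapsTo φ U V) (hleft : ∀ x ∈ U, ψ (φ x) = x)
    (hJ : ∀ x, J x = Matrix.det (Matrix.of fun a c : Fin n => pd c (fun y => φ y a) x))
    (hJpos : ∀ x ∈ U, 0 < J x) (δ : ℝ) {X X' : Fin n → (Fin n → ℝ) → ℝ} {x : Fin n → ℝ}
    (hx : x ∈ U) (hX : ∀ c, DifferentiableAt ℝ (X c) x)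
    (hX' : ∀ a, ∀ y ∈ V,
      X' a y = J (ψ y) ^ (-δ) * ∑ c, pd c (fun z => φ z a) (ψ y) * X c (ψ y)) :
    ∑ a, pd a (X' a) (φ x) = J x ^ (-δ) *
      (∑ c, pd c (X c) x + (1 - δ) * ∑ c, pd c (fun z => Real.log (J z)) x * X c x) := by
  have hφa (a : Fin n) : ContDiffOn ℝ (⊤ : ℕ∞) (fun z => φ z a) U := contDiffOn_pi.1 hφ a
  have hP (a c : Fin n) : DifferentiableAt ℝ (pd c fun z => φ z a) x :=
    ((contDiffOn_pd hU c (hφa a)).contDiffAt (hU.mem_nhds hx)).differentiableAt (by simp)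
  have hJd : DifferentiableAt ℝ J x :=
    ((contDiffOn_jacobian hU hφ hJ).contDiffAt (hU.mem_nhds hx)).differentiableAt (by simp)
  have hψd : DifferentiableAt ℝ ψ (φ x) :=
    (hψ.contDiffAt (hV.mem_nhds (hφUV hx))).differentiableAt (by simp)
  have hpos := hJpos x hx
  have hJr : DifferentiableAt ℝ (fun z => J z ^ (-δ)) x := hJd.rpow_const (Or.inl hpos.ne')
  have hPX (a c : Fin n) : DifferentiableAt ℝ (fun z => pd c (fun y => φ y a) z * X c z) x :=
    (hP a c).mul (hX c)
  have hPXs (a : Fin n) :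
      DifferentiableAt ℝ (fun z => ∑ c, pd c (fun y => φ y a) z * X c z) x :=
    DifferentiableAt.fun_sum fun c _ => hPX a c
  set h : Fin n → (Fin n → ℝ) → ℝ :=
    fun a z => J z ^ (-δ) * ∑ c, pd c (fun y => φ y a) z * X c z with hh
  have hpdX' (a : Fin n) :
      pd a (X' a) (φ x) = ∑ e, pd a (fun z => ψ z e) (φ x) * pd e (h a) x := by
    have hev : X' a =ᶠ[𝓝 (φ x)] fun y => h a (ψ y) :=
      Filter.eventually_of_mem (hV.mem_nhds (hφUV hx)) (hX' a)
    rw [pd_congr a hev, pd_comp a _ hψd, hleft x hx]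
    rw [hleft x hx]
    exact hJr.mul (hPXs a)
  have hpdh (a e : Fin n) : pd e (h a) x = J x ^ (-δ) * ∑ c,
      (-δ * (pd c (fun z => φ z a) x * (pd e (fun z => Real.log (J z)) x * X c x))
        + pd c (pd e fun z => φ z a) x * X c x
        + pd c (fun z => φ z a) x * pd e (X c) x) := by
    rw [hh, pd_mul e hJr (hPXs a), pd_rpow e _ hJd hpos, pd_sum _ _ fun c _ => hPX a c,
      Finset.mul_sum, Finset.mul_sum, Finset.mul_sum, ← Finset.sum_add_distrib]
    refine Finset.sum_congr rfl fun c _ => ?_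
    rw [pd_mul e (hP a c) (hX c), pd_comm e c ((hφa a).contDiffAt (hU.mem_nhds hx))]
    ring
  have hdual := sum_pd_mul_pd_inverse hU hV hφ hψ hφUV hleft hx
  have hlog : ∑ c, pd c (fun z => Real.log (J z)) x * X c x = ∑ a, ∑ e, ∑ c,
      pd a (fun z => ψ z e) (φ x) * (pd c (pd e fun z => φ z a) x * X c x) := by
    simp_rw [pd_log_jacobian hU hV hφ hψ hφUV hleft hJ hJpos hx, Finset.sum_mul]
    rw [Finset.sum_comm]
    refine Finset.sum_congr rfl fun a _ => ?_
    rw [Finset.sum_comm]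
    exact Finset.sum_congr rfl fun e _ => Finset.sum_congr rfl fun c _ => by ring
  have h₁ := sum_mul_of_dual hdual fun e c => pd e (fun z => Real.log (J z)) x * X c x
  have h₂ := sum_mul_of_dual hdual fun e c => pd e (X c) x
  have hsplit : (1 - δ) * ∑ c, pd c (fun z => Real.log (J z)) x * X c x
      = -δ * ∑ c, pd c (fun z => Real.log (J z)) x * X c x
        + ∑ c, pd c (fun z => Real.log (J z)) x * X c x := by ring
  rw [hsplit]
  nth_rewrite 2 [hlog]
  rw [← h₁, ← h₂]
  simp only [hpdX', hpdh, Finset.mul_sum, ← Finset.sum_add_distrib]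
  refine Finset.sum_congr rfl fun a _ => Finset.sum_congr rfl fun e _ =>
    Finset.sum_congr rfl fun c _ => by ring

/-- The second-order part of the pencil is a divergence. -/
lemma pencil_eq_div (δ lam : ℝ) {S : Fin n → Fin n → (Fin n → ℝ) → ℝ}
    (γ : Fin n → (Fin n → ℝ) → ℝ) (θ : (Fin n → ℝ) → ℝ) {f : (Fin n → ℝ) → ℝ} {x : Fin n → ℝ}
    (hS : ∀ a b, DifferentiableAt ℝ (S a b) x) (hf : ∀ a, DifferentiableAt ℝ (pd a f) x) :
    pencil δ lam S γ θ f x = (1/2) * (∑ b, pd b (fun z => ∑ a, S b a z * pd a f z) x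
      + (2*lam + δ - 1) * ∑ a, γ a x * pd a f x
      + lam * (∑ a, pd a (γ a) x) * f x
      + lam * (lam + δ - 1) * θ x * f x) := by
  have h (b : Fin n) : pd b (fun z => ∑ a, S b a z * pd a f z) x
      = ∑ a, (pd b (S b a) x * pd a f x + S b a x * pd b (pd a f) x) := by
    rw [pd_sum _ _ fun a _ => (hS b a).fun_mul (hf a)]
    exact Finset.sum_congr rfl fun a _ => pd_mul b (hS b a) (hf a)
  have hcomm : ∑ a, (∑ b, pd b (S b a) x) * pd a f x
      = ∑ b, ∑ a, pd b (S b a) x * pd a f x := by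
    simp_rw [Finset.sum_mul]
    exact Finset.sum_comm
  simp only [pencil, h, Finset.sum_add_distrib, hcomm]
  ring

end ChangeOfCoordinates

/-- covariance of the canonical pencil of weight `δ`: if `(S', γ', θ')` is
obtained from `(S, γ, θ)` by the transformation laws of a tensor density of weight `δ`,
an upper connection-density of weight `δ` and a Brans–Dicke field, then the two
coordinate expressions of the pencil define the same operator on densities of weight λ. -/
theorem statement4 (n : ℕ) (δ : ℝ) (U V : Set (Fin n → ℝ)) (hU : IsOpen U) (hV : IsOpen V)
    (φ ψ : (Fin n → ℝ) → (Fin n → ℝ))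
    (hφ : ContDiffOn ℝ (⊤ : ℕ∞) φ U) (hψ : ContDiffOn ℝ (⊤ : ℕ∞) ψ V)
    (hφUV : Set.MapsTo φ U V) (hψVU : Set.MapsTo ψ V U)
    (hleft : ∀ x ∈ U, ψ (φ x) = x) (hright : ∀ y ∈ V, φ (ψ y) = y)
    (J : (Fin n → ℝ) → ℝ)
    (hJ : ∀ x, J x = Matrix.det (Matrix.of fun a c : Fin n => pd c (fun y => φ y a) x))
    (hJpos : ∀ x ∈ U, 0 < J x)
    (S : Fin n → Fin n → (Fin n → ℝ) → ℝ) (γ : Fin n → (Fin n → ℝ) → ℝ)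
    (θ : (Fin n → ℝ) → ℝ)
    (hS : ∀ a b, ContDiffOn ℝ (⊤ : ℕ∞) (S a b) U) (hSsymm : ∀ a b, S a b = S b a)
    (hγ : ∀ a, ContDiffOn ℝ (⊤ : ℕ∞) (γ a) U) (hθ : ContDiffOn ℝ (⊤ : ℕ∞) θ U)
    -- transformed data on V:
    (S' : Fin n → Fin n → (Fin n → ℝ) → ℝ) (γ' : Fin n → (Fin n → ℝ) → ℝ)
    (θ' : (Fin n → ℝ) → ℝ)
    (hS' : ∀ a b y, S' a b y = (J (ψ y)) ^ (-δ) *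
      ∑ c, ∑ d, pd c (fun z => φ z a) (ψ y) * pd d (fun z => φ z b) (ψ y) * S c d (ψ y))
    (hγ' : ∀ a y, γ' a y = (J (ψ y)) ^ (-δ) *
      ∑ c, pd c (fun z => φ z a) (ψ y) *
        (γ c (ψ y) + ∑ d, S c d (ψ y) * pd d (fun z => Real.log (J z)) (ψ y)))
    (hθ' : ∀ y, θ' y = (J (ψ y)) ^ (-δ) *
      (θ (ψ y) + 2 * ∑ a, γ a (ψ y) * pd a (fun z => Real.log (J z)) (ψ y)
        + ∑ a, ∑ b, pd a (fun z => Real.log (J z)) (ψ y) * S a b (ψ y) *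
            pd b (fun z => Real.log (J z)) (ψ y))) :
    ∀ lam : ℝ, ∀ f : (Fin n → ℝ) → ℝ, ContDiff ℝ (⊤ : ℕ∞) f → ∀ y ∈ V,
      pencil δ lam S' γ' θ' f y
        = (J (ψ y)) ^ (-(lam + δ)) *
            pencil δ lam S γ θ (fun z => (J z) ^ lam * f (φ z)) (ψ y) := by
  intro lam f hf y hy
  have hx : ψ y ∈ U := hψVU hy
  have hφx : φ (ψ y) = y := hright y hy
  have hUx := hU.mem_nhds hx
  have hVy := hV.mem_nhds hy
  have hdU {h : (Fin n → ℝ) → ℝ} (hh : ContDiffOn ℝ (⊤ : ℕ∞) h U) {x : Fin n → ℝ}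
      (hx : x ∈ U) : DifferentiableAt ℝ h x :=
    (hh.contDiffAt (hU.mem_nhds hx)).differentiableAt (by simp)
  set g : (Fin n → ℝ) → ℝ := fun z => f (φ z) with hg
  set L : (Fin n → ℝ) → ℝ := fun z => Real.log (J z) with hL
  set X : Fin n → (Fin n → ℝ) → ℝ := fun c z => ∑ d, S c d z * pd d g z with hX
  set Z : Fin n → (Fin n → ℝ) → ℝ := fun c z => ∑ d, S c d z * pd d L z with hZ
  have sφ (a : Fin n) : ContDiffOn ℝ (⊤ : ℕ∞) (fun z => φ z a) U := contDiffOn_pi.1 hφ a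
  have sP (a c : Fin n) := contDiffOn_pd hU c (sφ a)
  have sJ : ContDiffOn ℝ (⊤ : ℕ∞) J U := contDiffOn_jacobian hU hφ hJ
  have sJr (r : ℝ) : ContDiffOn ℝ (⊤ : ℕ∞) (fun z => J z ^ r) U :=
    sJ.rpow_const_of_ne fun z hz => (hJpos z hz).ne'
  have sg : ContDiffOn ℝ (⊤ : ℕ∞) g U := hf.comp_contDiffOn hφ
  have sL : ContDiffOn ℝ (⊤ : ℕ∞) L U := sJ.log fun z hz => (hJpos z hz).ne'
  have sX (c : Fin n) : ContDiffOn ℝ (⊤ : ℕ∞) (X c) U :=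
    ContDiffOn.sum fun d _ => (hS c d).mul (contDiffOn_pd hU d sg)
  have sZ (c : Fin n) : ContDiffOn ℝ (⊤ : ℕ∞) (Z c) U :=
    ContDiffOn.sum fun d _ => (hS c d).mul (contDiffOn_pd hU d sL)
  have sF : ContDiffOn ℝ (⊤ : ℕ∞) (fun z => J z ^ lam * g z) U := (sJr lam).mul sg
  have sS' (a b : Fin n) : ContDiffOn ℝ (⊤ : ℕ∞) (S' a b) V := by
    rw [funext (hS' a b)]
    exact ((sJr (-δ)).mul (ContDiffOn.sum fun c _ => ContDiffOn.sum fun d _ =>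
      ((sP a c).mul (sP b d)).mul (hS c d))).comp hψ hψVU
  have hgd (d : Fin n) (z : Fin n → ℝ) (hz : z ∈ U) :
      pd d g z = ∑ e, pd d (fun w => φ w e) z * pd e f (φ z) :=
    pd_comp d (hf.differentiable (by simp) _)
      ((hφ.contDiffAt (hU.mem_nhds hz)).differentiableAt (by simp))
  have hFd (a : Fin n) (z : Fin n → ℝ) (hz : z ∈ U) :
      pd a (fun w => J w ^ lam * g w) z = J z ^ lam * (pd a g z + lam * g z * pd a L z) := by
    rw [pd_mul a (hdU (sJr lam) hz) (hdU sg hz), pd_rpow a lam (hdU sJ hz) (hJpos z hz)]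
    ring
  have hdivX' : ∑ b, pd b (fun z => ∑ a, S' b a z * pd a f z) y = J (ψ y) ^ (-δ) *
      (∑ c, pd c (X c) (ψ y) + (1 - δ) * ∑ c, pd c L (ψ y) * X c (ψ y)) := by
    conv_lhs => rw [← hφx]
    refine sum_pd_vectorDensity hU hV hφ hψ hφUV hleft hJ hJpos δ hx
      (fun c => hdU (sX c) hx) fun b w hw => ?_
    simp only [hS', hX]
    simp_rw [hgd _ _ (hψVU hw), hright w hw, Finset.mul_sum, Finset.sum_mul]
    rw [Finset.sum_comm]
    refine Finset.sum_congr rfl fun c _ => ?_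
    rw [Finset.sum_comm]
    exact Finset.sum_congr rfl fun d _ => Finset.sum_congr rfl fun a _ => by ring
  have hdivγ' : ∑ a, pd a (γ' a) y = J (ψ y) ^ (-δ) *
      (∑ c, pd c (fun z => γ c z + Z c z) (ψ y)
        + (1 - δ) * ∑ c, pd c L (ψ y) * (γ c (ψ y) + Z c (ψ y))) := by
    conv_lhs => rw [← hφx]
    exact sum_pd_vectorDensity hU hV hφ hψ hφUV hleft hJ hJpos δ hx
      (fun c => (hdU (hγ c) hx).add (hdU (sZ c) hx)) fun a w _ => hγ' a w
  have hγ'f : ∑ a, γ' a y * pd a f y = J (ψ y) ^ (-δ) *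
      ∑ c, (γ c (ψ y) + Z c (ψ y)) * pd c g (ψ y) := by
    simp_rw [hγ', hgd _ _ hx, hφx, Finset.mul_sum, Finset.sum_mul]
    rw [Finset.sum_comm]
    exact Finset.sum_congr rfl fun c _ => Finset.sum_congr rfl fun a _ => by ring
  have hdivF : ∑ b, pd b (fun z => ∑ a, S b a z * pd a (fun w => J w ^ lam * g w) z) (ψ y)
      = J (ψ y) ^ lam * (∑ b, pd b (X b) (ψ y) + lam * g (ψ y) * ∑ b, pd b (Z b) (ψ y)
        + lam * ∑ b, Z b (ψ y) * pd b g (ψ y)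
        + lam * ∑ b, pd b L (ψ y) * X b (ψ y)
        + lam ^ 2 * g (ψ y) * ∑ b, pd b L (ψ y) * Z b (ψ y)) := by
    simp only [Finset.mul_sum, ← Finset.sum_add_distrib]
    refine Finset.sum_congr rfl fun b _ => ?_
    have hev : (fun z => ∑ a, S b a z * pd a (fun w => J w ^ lam * g w) z) =ᶠ[𝓝 (ψ y)]
        fun z => J z ^ lam * (X b z + lam * (g z * Z b z)) := by
      refine Filter.eventually_of_mem hUx fun z hz => ?_
      simp only [hFd _ z hz, hX, hZ, Finset.mul_sum, ← Finset.sum_add_distrib]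
      exact Finset.sum_congr rfl fun a _ => by ring
    have dg := hdU sg hx
    have dX := hdU (sX b) hx
    have dZ := hdU (sZ b) hx
    have dgZ : DifferentiableAt ℝ (fun z => g z * Z b z) (ψ y) := dg.mul dZ
    have dlgZ : DifferentiableAt ℝ (fun z => lam * (g z * Z b z)) (ψ y) := dgZ.const_mul lam
    have hconst : pd b (fun _ => lam) (ψ y) = 0 := by simp [pd]
    rw [pd_congr b hev, pd_mul b (hdU (sJr lam) hx) (dX.fun_add dlgZ),
      pd_rpow b lam (hdU sJ hx) (hJpos _ hx), pd_add b dX dlgZ,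
      pd_mul b (differentiableAt_const lam) dgZ, pd_mul b dg dZ, hconst]
    ring
  have hγF : ∑ a, γ a (ψ y) * pd a (fun w => J w ^ lam * g w) (ψ y)
      = J (ψ y) ^ lam * (∑ a, γ a (ψ y) * pd a g (ψ y)
        + lam * g (ψ y) * ∑ a, γ a (ψ y) * pd a L (ψ y)) := by
    simp only [hFd _ _ hx, Finset.mul_sum, ← Finset.sum_add_distrib]
    exact Finset.sum_congr rfl fun a _ => by ring
  have hsymm : ∑ c, pd c L (ψ y) * X c (ψ y) = ∑ c, Z c (ψ y) * pd c g (ψ y) := by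
    simp only [hX, hZ, Finset.mul_sum, Finset.sum_mul]
    rw [Finset.sum_comm]
    refine Finset.sum_congr rfl fun c _ => Finset.sum_congr rfl fun d _ => ?_
    rw [hSsymm d c]
    ring
  have hγL : ∑ c, pd c L (ψ y) * γ c (ψ y) = ∑ c, γ c (ψ y) * pd c L (ψ y) :=
    Finset.sum_congr rfl fun c _ => mul_comm _ _
  have hLSL : ∑ a, ∑ b, pd a L (ψ y) * S a b (ψ y) * pd b L (ψ y)
      = ∑ c, pd c L (ψ y) * Z c (ψ y) := by
    simp only [hZ, Finset.mul_sum, mul_assoc]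
  have hfg : f y = g (ψ y) := by rw [hg]; simp only [hφx]
  have hpow : J (ψ y) ^ (-(lam + δ)) * J (ψ y) ^ lam = J (ψ y) ^ (-δ) := by
    rw [← Real.rpow_add (hJpos _ hx)]
    ring_nf
  have hγZ : ∑ c, pd c (fun z => γ c z + Z c z) (ψ y)
      = ∑ c, pd c (γ c) (ψ y) + ∑ c, pd c (Z c) (ψ y) := by
    rw [← Finset.sum_add_distrib]
    exact Finset.sum_congr rfl fun c _ => pd_add c (hdU (hγ c) hx) (hdU (sZ c) hx)
  have dpf (a : Fin n) : DifferentiableAt ℝ (pd a f) y :=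
    ((contDiffOn_pd isOpen_univ a hf.contDiffOn).contDiffAt Filter.univ_mem).differentiableAt
      (by simp)
  rw [pencil_eq_div δ lam γ' θ' (fun a b => ((sS' a b).contDiffAt hVy).differentiableAt (by simp))
      dpf,
    pencil_eq_div δ lam γ θ (fun a b => hdU (hS a b) hx)
      (fun a => hdU (contDiffOn_pd hU a sF) hx),
    hdivX', hdivγ', hγ'f, hdivF, hγF, hθ', hLSL, hfg, hγZ, ← hpow]
  simp only [mul_add, add_mul, Finset.sum_add_distrib, hsymm, hγL]
  ring
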